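/- Critical mixing time: if β = 1, then there are constants C₁, C₂ > 0 such that for all n, the mixing time of the Glauber dynamics for the Curie-Weiss Ising model on K_n satisfies C₁ n^{3/2} ≤ t_mix(n) ≤ C₂ n^{3/2}. -/

import Mathlib

open Filter Real

namespace CW

/-- Configurations of the Curie-Weiss model on `n` vertices:
`true` encodes spin `+1` and `false` encodes spin `-1`. -/
abbrev Config (n : ℕ) := Fin n → Bool

noncomputable section

/-- The spin (±1) at site `i`. -/
def spin {n : ℕ} (σ : Config n) (i : Fin n) : ℝ := if σ i then 1 else -1

/-- Normalized magnetization `S(σ) = n⁻¹ ∑ᵢ σ(i)`. -/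
def mag {n : ℕ} (σ : Config n) : ℝ := (∑ i, spin σ i) / n

/-- `p₊(s) = (1 + tanh(βs))/2`. -/
def pPlus (β s : ℝ) : ℝ := (1 + Real.tanh (β * s)) / 2

/-- One-step transition kernel of the Glauber dynamics for the Curie-Weiss
model: a uniformly chosen site `i` is refreshed, becoming `+1` with
probability `p₊(S(σ) - σ(i)/n)`. -/
def glauberKernel (β : ℝ) (n : ℕ) (σ η : Config n) : ℝ :=
  (1 / n) * ∑ i : Fin n,
    if ∀ j, j ≠ i → η j = σ j then
      (if η i then pPlus β (mag σ - spin σ i / n)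
       else 1 - pPlus β (mag σ - spin σ i / n))
    else 0

/-- Law of the Glauber dynamics at time `t` started from `σ`. -/
def glauberLaw (β : ℝ) (n : ℕ) : ℕ → Config n → Config n → ℝ
  | 0, σ, η => if η = σ then 1 else 0
  | t + 1, σ, η => ∑ τ : Config n, glauberLaw β n t σ τ * glauberKernel β n τ η

/-- The (normalized) exponent in the Curie-Weiss measure. -/
def cwExponent {n : ℕ} (β : ℝ) (σ : Config n) : ℝ :=
  (β / n) * ∑ i : Fin n, ∑ j : Fin n, if i < j then spin σ i * spin σ j else 0

/-- The Curie-Weiss (mean-field Ising) probability measure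
`μ(σ) = Z(β)⁻¹ exp((β/n) ∑_{i<j} σ(i)σ(j))`. -/
def cwMeasure (β : ℝ) (n : ℕ) (σ : Config n) : ℝ :=
  Real.exp (cwExponent β σ) / ∑ η : Config n, Real.exp (cwExponent β η)

/-- Total variation distance between two (discrete) distributions. -/
def tvDist {Ω : Type*} [Fintype Ω] (μ ν : Ω → ℝ) : ℝ :=
  (∑ x, |μ x - ν x|) / 2

/-- Worst-case total variation distance to stationarity at time `t`. -/
def glauberDist (β : ℝ) (n t : ℕ) : ℝ :=
  ⨆ σ : Config n, tvDist (glauberLaw β n t σ) (cwMeasure β n)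

/-- Mixing time of the Glauber dynamics. -/
def tMix (β : ℝ) (n : ℕ) : ℕ := sInf {t | glauberDist β n t ≤ 1 / 4}

/-! ### Analytic estimates for `tanh` -/

lemma hasDerivAt_tanh (x : ℝ) : HasDerivAt Real.tanh (1 - Real.tanh x ^ 2) x := by
  have h := (Real.hasDerivAt_sinh x).div (Real.hasDerivAt_cosh x) (Real.cosh_pos x).ne'
  have e : Real.tanh = fun y => Real.sinh y / Real.cosh y := funext Real.tanh_eq_sinh_div_cosh
  rw [e]
  refine h.congr_deriv ?_
  have := (Real.cosh_pos x).ne'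
  field_simp

lemma tanh_monotone : Monotone Real.tanh :=
  monotone_of_hasDerivAt_nonneg hasDerivAt_tanh fun x => by
    have := Real.tanh_sq_lt_one x
    simp only [Pi.zero_apply]
    linarith

lemma tanh_sub_le {a b : ℝ} (hab : a ≤ b) : Real.tanh b - Real.tanh a ≤ b - a := by
  have h : Monotone fun x => x - Real.tanh x :=
    monotone_of_hasDerivAt_nonneg (fun x => (hasDerivAt_id x).sub (hasDerivAt_tanh x)) fun x => by
      have := sq_nonneg (Real.tanh x)
      simp only [Pi.zero_apply]
      linarith
  have := h hab
  simp only at this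
  linarith

lemma exp_two_le_eight : Real.exp 2 ≤ 8 := by
  have h : Real.exp 2 = Real.exp 1 ^ 2 := by rw [← Real.exp_nat_mul]; norm_num
  have h1 := Real.exp_one_lt_d9
  have h0 := Real.exp_pos 1
  rw [h]
  nlinarith

lemma pPlus_eq (s : ℝ) : pPlus 1 s = 1 / (1 + Real.exp (-(2 * s))) := by
  have h : Real.exp (-(2 * s)) = Real.exp (-s) / Real.exp s := by
    rw [← Real.exp_sub]; ring_nf
  have h1 := Real.exp_pos s
  have h2 := Real.exp_pos (-s)
  rw [pPlus, Real.tanh_eq, one_mul, h]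
  field_simp
  ring

lemma pPlus_neg (s : ℝ) : pPlus 1 (-s) = 1 - pPlus 1 s := by
  simp only [pPlus, one_mul, Real.tanh_neg]; ring

lemma pPlus_monotone : Monotone (pPlus 1) := fun a b h => by
  have := tanh_monotone h
  simp only [pPlus, one_mul]
  linarith

lemma pPlus_pos (s : ℝ) : 0 < pPlus 1 s := by
  have := Real.neg_one_lt_tanh s
  simp only [pPlus, one_mul]; linarith

lemma pPlus_lt_one (s : ℝ) : pPlus 1 s < 1 := by
  have := Real.tanh_lt_one s
  simp only [pPlus, one_mul]; linarith

lemma one_ninth_le_pPlus {s : ℝ} (hs : -1 ≤ s) : 1 / 9 ≤ pPlus 1 s := by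
  refine le_trans ?_ (pPlus_monotone hs)
  have h := exp_two_le_eight
  have h0 := Real.exp_pos 2
  rw [pPlus_eq, show -(2 * (-1 : ℝ)) = 2 by norm_num]
  exact one_div_le_one_div_of_le (by linarith) (by linarith)

lemma pPlus_le_eight_ninths {s : ℝ} (hs : s ≤ 1) : pPlus 1 s ≤ 8 / 9 := by
  have h := one_ninth_le_pPlus (s := -s) (by linarith)
  rw [pPlus_neg] at h
  linarith

lemma tanh_sq_le {x : ℝ} (hx : x ∈ Set.Icc (-1 : ℝ) 1) : Real.tanh x ^ 2 ≤ 2 / 3 := by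
  have h1 := one_ninth_le_pPlus hx.1
  have h2 := pPlus_le_eight_ninths hx.2
  simp only [pPlus, one_mul] at h1 h2
  nlinarith

lemma div_three_le_tanh_sub {a b : ℝ} (ha : -1 ≤ a) (hab : a ≤ b) (hb : b ≤ 1) :
    (b - a) / 3 ≤ Real.tanh b - Real.tanh a := by
  have h : MonotoneOn (fun x => Real.tanh x - x / 3) (Set.Icc (-1) 1) := by
    refine monotoneOn_of_hasDerivWithinAt_nonneg (f' := fun x => (1 - Real.tanh x ^ 2) - 1 / 3)
      (convex_Icc _ _) ?_ ?_ ?_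
    · exact fun x _ => ((hasDerivAt_tanh x).sub
        ((hasDerivAt_id x).div_const 3)).continuousAt.continuousWithinAt
    · exact fun x _ => ((hasDerivAt_tanh x).sub
        ((hasDerivAt_id x).div_const 3)).hasDerivWithinAt
    · intro x hx
      have := tanh_sq_le (interior_subset hx)
      linarith
  have := h ⟨ha, hab.trans hb⟩ ⟨ha.trans hab, hb⟩ hab
  simp only at this
  linarith

lemma sub_cube_le_tanh {s : ℝ} (hs : 0 ≤ s) : s - s ^ 3 ≤ Real.tanh s := by
  have h : MonotoneOn (fun x => Real.tanh x - (x - x ^ 3)) (Set.Ici 0) := by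
    have hd : ∀ x : ℝ, HasDerivAt (fun x => Real.tanh x - (x - x ^ 3))
        ((1 - Real.tanh x ^ 2) - (1 - 3 * x ^ 2)) x := fun x =>
      ((hasDerivAt_tanh x).sub ((hasDerivAt_id x).sub (hasDerivAt_pow 3 x))).congr_deriv (by simp)
    refine monotoneOn_of_hasDerivWithinAt_nonneg (convex_Ici _)
      (fun x _ => (hd x).continuousAt.continuousWithinAt)
      (fun x _ => (hd x).hasDerivWithinAt) ?_
    intro x hx
    have hx0 : 0 ≤ x := interior_subset hx
    have h1 := tanh_sub_le hx0
    have h2 := tanh_monotone hx0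
    simp only [Real.tanh_zero] at h1 h2
    nlinarith
  have := h Set.self_mem_Ici hs hs
  simp only [Real.tanh_zero] at this
  linarith

/-- Four times the drift of the number of plus spins at magnetization `s`, with `ε = 1 / n`. -/
def drift (ε s : ℝ) : ℝ :=
  (1 - s) * Real.tanh (s + ε) + (1 + s) * Real.tanh (s - ε) - 2 * s

lemma drift_neg (ε s : ℝ) : drift ε (-s) = -drift ε s := by
  have h1 : -s + ε = -(s - ε) := by ring
  have h2 : -s - ε = -(s + ε) := by ring
  rw [drift, drift, h1, h2, Real.tanh_neg, Real.tanh_neg]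
  ring

lemma hasDerivAt_drift (ε s : ℝ) : HasDerivAt (drift ε)
    (-((1 - s) * Real.tanh (s + ε) ^ 2 + (1 + s) * Real.tanh (s - ε) ^ 2
      + (Real.tanh (s + ε) - Real.tanh (s - ε)))) s := by
  have h1 : HasDerivAt (fun s => Real.tanh (s + ε)) (1 - Real.tanh (s + ε) ^ 2) s :=
    (hasDerivAt_tanh (s + ε)).comp_add_const s ε
  have h2 : HasDerivAt (fun s => Real.tanh (s - ε)) (1 - Real.tanh (s - ε) ^ 2) s :=
    (hasDerivAt_tanh (s - ε)).comp_sub_const s ε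
  have h3 := ((((hasDerivAt_id s).const_sub 1).mul h1).add
    (((hasDerivAt_id s).const_add 1).mul h2)).sub ((hasDerivAt_id s).const_mul 2)
  refine h3.congr_deriv ?_
  simp only [id]
  ring

lemma sq_div_le_of_nonneg {ε s : ℝ} (hε : 0 ≤ ε) (hs : 0 ≤ s) (hs1 : s ≤ 1) :
    s ^ 2 / 36 ≤ (1 - s) * Real.tanh (s + ε) ^ 2 + (1 + s) * Real.tanh (s - ε) ^ 2
      + (Real.tanh (s + ε) - Real.tanh (s - ε)) := by
  have h0 : 0 ≤ (1 - s) * Real.tanh (s + ε) ^ 2 := mul_nonneg (by linarith) (sq_nonneg _)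
  have h1 : Real.tanh (s - ε) ^ 2 ≤ (1 + s) * Real.tanh (s - ε) ^ 2 := by
    nlinarith [sq_nonneg (Real.tanh (s - ε))]
  rcases le_total ε (s / 2) with h | h
  · have h2 := div_three_le_tanh_sub (a := 0) (b := s - ε) (by norm_num) (by linarith)
      (by linarith)
    have h3 := tanh_monotone (show s - ε ≤ s + ε by linarith)
    rw [Real.tanh_zero] at h2
    have h4 : s / 6 ≤ Real.tanh (s - ε) := by linarith
    nlinarith
  · have h2 := div_three_le_tanh_sub (a := s / 2) (b := s) (by linarith) (by linarith) hs1
    have h3 := tanh_monotone (show s ≤ s + ε by linarith)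
    have h4 := tanh_monotone (show s - ε ≤ s / 2 by linarith)
    nlinarith [sq_nonneg (Real.tanh (s - ε))]

lemma sq_div_le {ε s : ℝ} (hε : 0 ≤ ε) (hs : s ∈ Set.Icc (-1 : ℝ) 1) :
    s ^ 2 / 36 ≤ (1 - s) * Real.tanh (s + ε) ^ 2 + (1 + s) * Real.tanh (s - ε) ^ 2
      + (Real.tanh (s + ε) - Real.tanh (s - ε)) := by
  rcases le_total 0 s with h | h
  · exact sq_div_le_of_nonneg hε h hs.2
  · have h1 := sq_div_le_of_nonneg hε (s := -s) (by linarith) (by linarith [hs.1])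
    rw [show -s + ε = -(s - ε) by ring, show -s - ε = -(s + ε) by ring, Real.tanh_neg,
      Real.tanh_neg] at h1
    linarith

lemma antitoneOn_drift_add_cube {ε : ℝ} (hε : 0 ≤ ε) :
    AntitoneOn (fun s => drift ε s + s ^ 3 / 108) (Set.Icc (-1) 1) := by
  have hd : ∀ s : ℝ, HasDerivAt (fun s => drift ε s + s ^ 3 / 108)
      (-((1 - s) * Real.tanh (s + ε) ^ 2 + (1 + s) * Real.tanh (s - ε) ^ 2
      + (Real.tanh (s + ε) - Real.tanh (s - ε))) + 3 * s ^ 2 / 108) s := fun s =>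
    ((hasDerivAt_drift ε s).add ((hasDerivAt_pow 3 s).div_const 108)).congr_deriv (by simp)
  refine antitoneOn_of_hasDerivWithinAt_nonpos (convex_Icc _ _)
    (fun x _ => (hd x).continuousAt.continuousWithinAt)
    (fun x _ => (hd x).hasDerivWithinAt) ?_
  intro s hs
  have := sq_div_le hε (interior_subset hs)
  linarith

lemma drift_sub_le {ε s t : ℝ} (hε : 0 ≤ ε) (hs : -1 ≤ s) (hst : s ≤ t)
    (ht : t ≤ 1) : drift ε t - drift ε s ≤ -(t - s) ^ 3 / 432 := by
  have h := antitoneOn_drift_add_cube hε ⟨hs, hst.trans ht⟩ ⟨hs.trans hst, ht⟩ hst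
  simp only at h
  have h2 : (t - s) ^ 3 / 4 ≤ t ^ 3 - s ^ 3 := by
    nlinarith [mul_nonneg (sub_nonneg.2 hst) (sq_nonneg (t + s))]
  linarith

lemma neg_le_drift {ε s : ℝ} (hε : 0 ≤ ε) (hs : 0 ≤ s) (hs1 : s ≤ 1) :
    -(2 * s ^ 3 + 2 * ε) ≤ drift ε s := by
  have h1 := tanh_monotone (show s ≤ s + ε by linarith)
  have h2 := tanh_sub_le (show s - ε ≤ s by linarith)
  have h3 := sub_cube_le_tanh hs
  have h4 : (1 - s) * Real.tanh s ≤ (1 - s) * Real.tanh (s + ε) :=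
    mul_le_mul_of_nonneg_left h1 (by linarith)
  have h5 : (1 + s) * (Real.tanh s - ε) ≤ (1 + s) * Real.tanh (s - ε) :=
    mul_le_mul_of_nonneg_left (by linarith) (by linarith)
  rw [drift]
  nlinarith

/-! ### The birth-and-death chain of the number of plus spins -/

/-- Normalized magnetization of a configuration with `k` plus spins. -/
def magAt (n : ℕ) (k : ℤ) : ℝ := (2 * k - n) / n

/-- Probability that the number of plus spins increases from `k`. -/
def birthRate (n : ℕ) (k : ℤ) : ℝ := (1 - k / n) * pPlus 1 (magAt n k + 1 / n)

/-- Probability that the number of plus spins decreases from `k`. -/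
def deathRate (n : ℕ) (k : ℤ) : ℝ := (k / n) * (1 - pPlus 1 (magAt n k - 1 / n))

/-- Transition operator of the number of plus spins. -/
def magOp (n : ℕ) (f : ℤ → ℝ) (k : ℤ) : ℝ :=
  birthRate n k * f (k + 1) + deathRate n k * f (k - 1)
    + (1 - birthRate n k - deathRate n k) * f k

section Rates

variable {n : ℕ} {k x y : ℤ}

lemma magAt_add (hn : 0 < n) : magAt n k + 1 / n = (2 * k + 1) / n - 1 := by
  have : (n : ℝ) ≠ 0 := by positivity
  rw [magAt]; field_simp; ring

lemma magAt_sub (hn : 0 < n) : magAt n k - 1 / n = (2 * k - 1) / n - 1 := by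
  have : (n : ℝ) ≠ 0 := by positivity
  rw [magAt]; field_simp; ring

lemma magAt_mem_Icc (hn : 0 < n) (hk : 0 ≤ k) (hkn : k ≤ n) : magAt n k ∈ Set.Icc (-1 : ℝ) 1 := by
  have h0 : (0 : ℝ) < n := by positivity
  have h1 : (0 : ℝ) ≤ k := by exact_mod_cast hk
  have h2 : (k : ℝ) ≤ n := by exact_mod_cast hkn
  rw [magAt, Set.mem_Icc, le_div_iff₀ h0, div_le_iff₀ h0]
  constructor <;> linarith

lemma birthRate_self (hn : 0 < n) : birthRate n n = 0 := by
  have : (n : ℝ) ≠ 0 := by positivity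
  simp [birthRate, this]

lemma deathRate_zero : deathRate n 0 = 0 := by simp [deathRate]

lemma frac_mem_Icc (hn : 0 < n) (hk : 0 ≤ k) (hkn : k ≤ n) : (k : ℝ) / n ∈ Set.Icc (0 : ℝ) 1 := by
  have h0 : (0 : ℝ) < n := by positivity
  have h1 : (0 : ℝ) ≤ k := by exact_mod_cast hk
  have h2 : (k : ℝ) ≤ n := by exact_mod_cast hkn
  exact ⟨by positivity, (div_le_one h0).2 h2⟩

lemma birthRate_nonneg (hn : 0 < n) (hk : 0 ≤ k) (hkn : k ≤ n) : 0 ≤ birthRate n k :=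
  mul_nonneg (sub_nonneg.2 (frac_mem_Icc hn hk hkn).2) (pPlus_pos _).le

lemma deathRate_nonneg (hn : 0 < n) (hk : 0 ≤ k) (hkn : k ≤ n) : 0 ≤ deathRate n k :=
  mul_nonneg (frac_mem_Icc hn hk hkn).1 (sub_nonneg.2 (pPlus_lt_one _).le)

lemma birthRate_le (hn : 0 < n) (hk : 0 ≤ k) (hkn : k ≤ n) : birthRate n k ≤ 1 - k / n :=
  mul_le_of_le_one_right (sub_nonneg.2 (frac_mem_Icc hn hk hkn).2) (pPlus_lt_one _).le

lemma deathRate_le (hn : 0 < n) (hk : 0 ≤ k) (hkn : k ≤ n) : deathRate n k ≤ k / n :=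
  mul_le_of_le_one_right (frac_mem_Icc hn hk hkn).1 (by linarith [pPlus_pos (magAt n k - 1 / n)])

lemma birthRate_add_deathRate_le (hn : 0 < n) (hk : 0 ≤ k) (hkn : k ≤ n) :
    birthRate n k + deathRate n k ≤ 1 := by
  linarith [birthRate_le hn hk hkn, deathRate_le hn hk hkn]

lemma le_birthRate (hn : 0 < n) (hk : 0 ≤ k) (hkn : k ≤ n) :
    (1 - k / n) * (1 / 9) ≤ birthRate n k := by
  refine mul_le_mul_of_nonneg_left (one_ninth_le_pPlus ?_)
    (sub_nonneg.2 (frac_mem_Icc hn hk hkn).2)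
  have := (magAt_mem_Icc hn hk hkn).1
  have : (0 : ℝ) ≤ 1 / n := by positivity
  linarith

lemma le_deathRate (hn : 0 < n) (hk : 0 ≤ k) (hkn : k ≤ n) :
    (k / n) * (1 / 9) ≤ deathRate n k := by
  have h1 := (magAt_mem_Icc hn hk hkn).2
  have h2 : (0 : ℝ) ≤ 1 / n := by positivity
  have h3 := pPlus_le_eight_ninths (s := magAt n k - 1 / n) (by linarith)
  exact mul_le_mul_of_nonneg_left (by linarith) (frac_mem_Icc hn hk hkn).1

lemma birthRate_le_eight_ninths (hn : 0 < n) (hk : 0 ≤ k) (hkn : k ≤ n) :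
    birthRate n k ≤ 8 / 9 := by
  rcases hkn.eq_or_lt with rfl | h
  · rw [birthRate_self hn]; norm_num
  · have h0 : (0 : ℝ) < n := by positivity
    have h1 : (k : ℝ) + 1 ≤ n := by exact_mod_cast h
    refine (mul_le_of_le_one_left (pPlus_pos _).le ?_).trans (pPlus_le_eight_ninths ?_)
    · linarith [(frac_mem_Icc hn hk hkn).1]
    · rw [magAt_add hn, sub_le_iff_le_add, div_le_iff₀ h0]
      linarith

lemma deathRate_le_eight_ninths (hn : 0 < n) (hk : 0 ≤ k) (hkn : k ≤ n) :
    deathRate n k ≤ 8 / 9 := by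
  rcases hk.eq_or_lt with rfl | h
  · rw [deathRate_zero]; norm_num
  · have h0 : (0 : ℝ) < n := by positivity
    have h1 : (1 : ℝ) ≤ k := by exact_mod_cast h
    have h2 : 1 / 9 ≤ pPlus 1 (magAt n k - 1 / n) := by
      refine one_ninth_le_pPlus ?_
      rw [magAt_sub hn]
      have : 0 ≤ (2 * (k : ℝ) - 1) / n := div_nonneg (by linarith) h0.le
      linarith
    refine (mul_le_of_le_one_left (by linarith [pPlus_lt_one (magAt n k - 1 / n)])
      (frac_mem_Icc hn hk hkn).2).trans (by linarith)

lemma birthRate_mul_deathRate_le (hn : 0 < n) (hx : 0 ≤ x) (hxy : x < y) (hy : y ≤ n) :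
    birthRate n x * deathRate n y ≤
      (1 - birthRate n x - deathRate n x) * (1 - birthRate n y - deathRate n y) := by
  have hxn : x ≤ n := by omega
  have hy0 : 0 ≤ y := by omega
  have h0 : (0 : ℝ) < n := by positivity
  have hfx := frac_mem_Icc hn hx hxn
  have hfy := frac_mem_Icc hn hy0 hy
  have hp : pPlus 1 (magAt n x + 1 / n) ≤ pPlus 1 (magAt n y - 1 / n) := by
    refine pPlus_monotone ?_
    have : (x : ℝ) + 1 ≤ y := by exact_mod_cast hxy
    rw [magAt_add hn, magAt_sub hn]
    gcongr
    linarith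
  have h1 : (1 - (x : ℝ) / n) * (1 - pPlus 1 (magAt n x + 1 / n))
      ≤ 1 - birthRate n x - deathRate n x := by
    have := deathRate_le hn hx hxn
    rw [birthRate]; linarith
  have h2 : (y : ℝ) / n * pPlus 1 (magAt n y - 1 / n) ≤ 1 - birthRate n y - deathRate n y := by
    have := birthRate_le hn hy0 hy
    rw [deathRate]; linarith
  have hp1 := pPlus_pos (magAt n x + 1 / n)
  have hp2 := pPlus_lt_one (magAt n y - 1 / n)
  calc birthRate n x * deathRate n y
      = ((1 - (x : ℝ) / n) * ((y : ℝ) / n)) *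
        (pPlus 1 (magAt n x + 1 / n) * (1 - pPlus 1 (magAt n y - 1 / n))) := by
        rw [birthRate, deathRate]; ring
    _ ≤ ((1 - (x : ℝ) / n) * ((y : ℝ) / n)) *
        ((1 - pPlus 1 (magAt n x + 1 / n)) * pPlus 1 (magAt n y - 1 / n)) := by
        refine mul_le_mul_of_nonneg_left ?_ (mul_nonneg (sub_nonneg.2 hfx.2) hfy.1)
        nlinarith
    _ = ((1 - (x : ℝ) / n) * (1 - pPlus 1 (magAt n x + 1 / n))) *
        ((y : ℝ) / n * pPlus 1 (magAt n y - 1 / n)) := by ring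
    _ ≤ _ := mul_le_mul h1 h2 (mul_nonneg hfy.1 (by linarith))
        (le_trans (mul_nonneg (sub_nonneg.2 hfx.2) (by linarith)) h1)

lemma birthRate_sub_deathRate (n : ℕ) (k : ℤ) (hn : 0 < n) :
    birthRate n k - deathRate n k = drift (1 / n) (magAt n k) / 4 := by
  have h0 : (n : ℝ) ≠ 0 := by positivity
  have hk : (k : ℝ) / n = (1 + magAt n k) / 2 := by
    rw [magAt]; field_simp; ring
  rw [birthRate, deathRate, hk, drift, pPlus, pPlus, one_mul, one_mul]
  ring

lemma drift_contraction (hn : 0 < n) (hx : 0 ≤ x) (hxy : x ≤ y) (hy : y ≤ n) :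
    (birthRate n y - deathRate n y) - (birthRate n x - deathRate n x)
      ≤ -(((y : ℝ) - x) / n) ^ 3 / 216 := by
  have h0 : (0 : ℝ) < n := by positivity
  have hxy' : (x : ℝ) ≤ y := by exact_mod_cast hxy
  have h := drift_sub_le (ε := 1 / n) (by positivity)
    (magAt_mem_Icc hn hx (hxy.trans hy)).1 (show magAt n x ≤ magAt n y by
      rw [magAt, magAt]; gcongr) (magAt_mem_Icc hn (hx.trans hxy) hy).2
  have e : magAt n y - magAt n x = 2 * (((y : ℝ) - x) / n) := by
    rw [magAt, magAt]; ring
  rw [e] at h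
  rw [birthRate_sub_deathRate n y hn, birthRate_sub_deathRate n x hn]
  have : (2 * (((y : ℝ) - x) / n)) ^ 3 = 8 * (((y : ℝ) - x) / n) ^ 3 := by ring
  linarith

end Rates

/-! ### A coupling of two copies of the chain that do not jump over each other -/

/-- Transition operator of a coupling of two copies of the birth-and-death chain, started at
`x < y` and stopped when they meet. The copies move independently, except that they never move
towards each other simultaneously. -/
def coupOp (n : ℕ) (H : ℤ → ℤ → ℝ) (x y : ℤ) : ℝ :=
  if x < y then
    birthRate n x * birthRate n y * H (x + 1) (y + 1)
    + birthRate n x * (1 - birthRate n y) * H (x + 1) y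
    + deathRate n x * birthRate n y * H (x - 1) (y + 1)
    + deathRate n x * deathRate n y * H (x - 1) (y - 1)
    + deathRate n x * (1 - birthRate n y - deathRate n y) * H (x - 1) y
    + (1 - birthRate n x - deathRate n x) * birthRate n y * H x (y + 1)
    + (1 - deathRate n x) * deathRate n y * H x (y - 1)
    + ((1 - birthRate n x - deathRate n x) * (1 - birthRate n y - deathRate n y)
      - birthRate n x * deathRate n y) * H x y
  else 0

section Coupling

variable {n : ℕ} {x y : ℤ}

lemma coupOp_mono (hn : 0 < n) {H H' : ℤ → ℤ → ℝ}
    (hH : ∀ x y : ℤ, 0 ≤ x → x ≤ y → y ≤ n → H x y ≤ H' x y)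
    (hx : 0 ≤ x) (hy : y ≤ n) : coupOp n H x y ≤ coupOp n H' x y := by
  unfold coupOp
  split_ifs with hxy
  swap
  · exact le_rfl
  have hxn : x ≤ n := by omega
  have hy0 : 0 ≤ y := by omega
  have ux := birthRate_nonneg hn hx hxn
  have uy := birthRate_nonneg hn hy0 hy
  have dx := deathRate_nonneg hn hx hxn
  have dy := deathRate_nonneg hn hy0 hy
  have sx := birthRate_add_deathRate_le hn hx hxn
  have sy := birthRate_add_deathRate_le hn hy0 hy
  have hxL : deathRate n x = 0 ∨ 0 ≤ x - 1 := by
    rcases hx.eq_or_lt with rfl | h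
    · exact Or.inl deathRate_zero
    · exact Or.inr (by omega)
  have hyR : birthRate n y = 0 ∨ y + 1 ≤ n := by
    rcases hy.eq_or_lt with rfl | h
    · exact Or.inl (birthRate_self hn)
    · exact Or.inr (by omega)
  have key : ∀ (c : ℝ) (a b : ℤ), 0 ≤ c → (c = 0 ∨ (0 ≤ a ∧ a ≤ b ∧ b ≤ n)) →
      c * H a b ≤ c * H' a b := by
    rintro c a b hc (rfl | ⟨h1, h2, h3⟩)
    · simp
    · exact mul_le_mul_of_nonneg_left (hH a b h1 h2 h3) hc
  refine add_le_add (add_le_add (add_le_add (add_le_add (add_le_add (add_le_add (add_le_add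
    (key _ _ _ (mul_nonneg ux uy) ?_) (key _ _ _ (mul_nonneg ux (by linarith)) ?_))
    (key _ _ _ (mul_nonneg dx uy) ?_)) (key _ _ _ (mul_nonneg dx dy) ?_))
    (key _ _ _ (mul_nonneg dx (by linarith)) ?_))
    (key _ _ _ (mul_nonneg (by linarith) uy) ?_))
    (key _ _ _ (mul_nonneg (by linarith) dy) ?_))
    (key _ _ _ (by linarith [birthRate_mul_deathRate_le hn hx hxy hy]) ?_)
  · rcases hyR with h | h
    · simp [h]
    · right; omega
  · right; omega
  · rcases hyR with h | h
    · simp [h]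
    · rcases hxL with h' | h'
      · simp [h']
      · right; omega
  · rcases hxL with h' | h'
    · simp [h']
    · right; omega
  · rcases hxL with h' | h'
    · simp [h']
    · right; omega
  · rcases hyR with h | h
    · simp [h]
    · right; omega
  · right; omega
  · right; omega

lemma magOp_sub_magOp (f : ℤ → ℝ) (hxy : x < y) :
    magOp n f y - magOp n f x = coupOp n (fun a b => f b - f a) x y := by
  rw [coupOp, if_pos hxy, magOp, magOp]
  ring

lemma abs_magOp_sub_le (hn : 0 < n) {f : ℤ → ℝ} {H : ℤ → ℤ → ℝ}
    (hH : ∀ x y : ℤ, 0 ≤ x → x ≤ y → y ≤ n → |f y - f x| ≤ H x y)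
    (hx : 0 ≤ x) (hxy : x ≤ y) (hy : y ≤ n) :
    |magOp n f y - magOp n f x| ≤ coupOp n H x y := by
  rcases hxy.eq_or_lt with rfl | h
  · simp [coupOp]
  · rw [abs_le]
    constructor
    · have h1 := coupOp_mono hn (H := fun a b => (fun z => -f z) b - (fun z => -f z) a) (H' := H)
        (fun a b h1 h2 h3 => by linarith [neg_abs_le (f b - f a), hH a b h1 h2 h3]) hx hy
      rw [← magOp_sub_magOp _ h] at h1
      simp only [magOp] at h1 ⊢
      linarith
    · rw [magOp_sub_magOp _ h]
      exact coupOp_mono hn (fun a b h1 h2 h3 => (le_abs_self _).trans (hH a b h1 h2 h3)) hx hy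

/-- Concave Lyapunov function of the distance between the two copies. -/
def lyap (M w D : ℝ) : ℝ := M * (D / (w + D))

lemma lyap_add_le {M w D ξ : ℝ} (hM : 0 ≤ M) (hw : 0 < w) (hD : 0 ≤ D) (hξ : 0 < w + D + ξ)
    (hξ2 : ξ ≤ w + D) :
    lyap M w (D + ξ) ≤ lyap M w D + M * w / (w + D) ^ 2 * (ξ - ξ ^ 2 / (2 * (w + D))) := by
  have hG : 0 < w + D := by linarith
  have e : lyap M w (D + ξ) - lyap M w D = M * w / (w + D) ^ 2 * (ξ - ξ ^ 2 / (w + D + ξ)) := by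
    have h1 : w + (D + ξ) = w + D + ξ := by ring
    rw [lyap, lyap, h1]
    have := hξ.ne'
    have := hG.ne'
    field_simp
    ring
  have h2 : ξ ^ 2 / (2 * (w + D)) ≤ ξ ^ 2 / (w + D + ξ) := by
    gcongr
    linarith
  have h3 : M * w / (w + D) ^ 2 * (ξ - ξ ^ 2 / (w + D + ξ))
      ≤ M * w / (w + D) ^ 2 * (ξ - ξ ^ 2 / (2 * (w + D))) :=
    mul_le_mul_of_nonneg_left (by linarith) (by positivity)
  linarith

lemma coupOp_lyap_le_aux (hn : 0 < n) {M w : ℝ} (hM : 0 ≤ M) (hw : 1 ≤ w)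
    (hx : 0 ≤ x) (hxy : x < y) (hy : y ≤ n) :
    coupOp n (fun a b => lyap M w (b - a)) x y ≤ lyap M w (y - x)
      - M * w / (w + (y - x)) ^ 2 *
        ((((y : ℝ) - x) / n) ^ 3 / 216 + 1 / (162 * (w + (y - x)))) := by
  have hxn : x ≤ n := by omega
  have hy0 : 0 ≤ y := by omega
  have hD : (1 : ℝ) ≤ (y : ℝ) - x := by
    have : (x : ℝ) + 1 ≤ y := by exact_mod_cast hxy
    linarith
  have hdrift := drift_contraction hn hx hxy.le hy
  have ux := birthRate_nonneg hn hx hxn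
  have uy := birthRate_nonneg hn hy0 hy
  have dx := deathRate_nonneg hn hx hxn
  have dy := deathRate_nonneg hn hy0 hy
  have sx := birthRate_add_deathRate_le hn hx hxn
  have sy := birthRate_add_deathRate_le hn hy0 hy
  have ux' := le_birthRate hn hx hxn
  have dy' := le_deathRate hn hy0 hy
  have uy' := birthRate_le_eight_ninths hn hy0 hy
  have dx' := deathRate_le_eight_ninths hn hx hxn
  have hfrac : (x : ℝ) / n ≤ y / n := by
    have : (x : ℝ) ≤ y := by linarith
    gcongr
  rw [coupOp, if_pos hxy]
  push_cast
  generalize hDD : (y : ℝ) - x = D at *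
  have e1 : (y : ℝ) + 1 - (x + 1) = D := by linarith
  have e2 : (y : ℝ) - (x + 1) = D + -1 := by linarith
  have e3 : (y : ℝ) + 1 - (x - 1) = D + 2 := by linarith
  have e4 : (y : ℝ) - 1 - (x - 1) = D := by linarith
  have e5 : (y : ℝ) - (x - 1) = D + 1 := by linarith
  have e6 : (y : ℝ) + 1 - x = D + 1 := by linarith
  have e7 : (y : ℝ) - 1 - x = D + -1 := by linarith
  rw [e1, e2, e3, e4, e5, e6, e7]
  have hm := lyap_add_le (ξ := -1) hM (by linarith : 0 < w) (by linarith : 0 ≤ D) (by linarith)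
    (by linarith)
  have h1 := lyap_add_le (ξ := 1) hM (by linarith : 0 < w) (by linarith : 0 ≤ D) (by linarith)
    (by linarith)
  have h2 := lyap_add_le (ξ := 2) hM (by linarith : 0 < w) (by linarith : 0 ≤ D) (by linarith)
    (by linarith)
  have hc : 0 ≤ M * w / (w + D) ^ 2 := by positivity
  generalize M * w / (w + D) ^ 2 = c at *
  have hg : 0 < 1 / (2 * (w + D)) := by positivity
  have hg' : 1 / (162 * (w + D)) = 1 / (2 * (w + D)) / 81 := by
    have : w + D ≠ 0 := by linarith
    field_simp; norm_num
  have hm' : (-1 : ℝ) ^ 2 / (2 * (w + D)) = 1 / (2 * (w + D)) := by norm_num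
  have h2' : (2 : ℝ) ^ 2 / (2 * (w + D)) = 4 * (1 / (2 * (w + D))) := by ring
  rw [hm'] at hm
  rw [one_pow] at h1
  rw [h2'] at h2
  rw [hg']
  generalize 1 / (2 * (w + D)) = g at *
  generalize lyap M w (D + -1) = lm at *
  generalize lyap M w (D + 1) = l1 at *
  generalize lyap M w (D + 2) = l2 at *
  generalize lyap M w D = l0 at *
  generalize birthRate n x = a at *
  generalize birthRate n y = b at *
  generalize deathRate n x = p at *
  generalize deathRate n y = q at *
  have hvar : 1 / 81 ≤ a * (1 - b) + (1 - p) * q := by nlinarith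
  have w1 : 0 ≤ a * (1 - b) + (1 - p) * q := by linarith
  have w2 : 0 ≤ p * b := mul_nonneg dx uy
  have w3 : 0 ≤ p * (1 - b - q) + (1 - a - p) * b :=
    add_nonneg (mul_nonneg dx (by linarith)) (mul_nonneg (by linarith) uy)
  have m1 := mul_le_mul_of_nonneg_left hm w1
  have m2 := mul_le_mul_of_nonneg_left h2 w2
  have m3 := mul_le_mul_of_nonneg_left h1 w3
  have m4 : c * ((b - q) - (a - p)) ≤ c * (-(D / n) ^ 3 / 216) :=
    mul_le_mul_of_nonneg_left hdrift hc
  have m5 : c * g * (1 / 81) ≤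
      c * g * (a * (1 - b) + (1 - p) * q + 4 * (p * b) + (p * (1 - b - q) + (1 - a - p) * b)) :=
    mul_le_mul_of_nonneg_left (by linarith) (mul_nonneg hc hg.le)
  linarith

lemma lyap_gain {w z : ℝ} (hw : 0 < w) (hz : 0 ≤ z) :
    1 ≤ 1296 * w ^ 2 * w / (w + w * z) ^ 2 *
      ((w * z) ^ 3 / w ^ 4 / 216 + 1 / (162 * (w + w * z))) := by
  have e : 1296 * w ^ 2 * w / (w + w * z) ^ 2 *
      ((w * z) ^ 3 / w ^ 4 / 216 + 1 / (162 * (w + w * z)))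
      = (6 * z ^ 3 * (1 + z) + 8) / (1 + z) ^ 3 := by
    have : 1 + z ≠ 0 := by linarith
    have e2 : w + w * z = w * (1 + z) := by ring
    rw [e2]
    field_simp
    ring
  rw [e, le_div_iff₀ (by positivity)]
  rcases le_total z 1 with h | h
  · have : (1 + z) ^ 3 ≤ 2 ^ 3 := by gcongr; linarith
    have : 0 ≤ 6 * z ^ 3 * (1 + z) := by positivity
    linarith
  · have h1 : (1 + z) ^ 2 ≤ (2 * z) ^ 2 := by gcongr; linarith
    have h2 : z ^ 2 ≤ z ^ 3 := pow_le_pow_right₀ h (by norm_num)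
    nlinarith

lemma coupOp_lyap_le (hn : 0 < n) {w : ℝ} (hw : 1 ≤ w) (hwn : w ^ 4 = n ^ 3)
    (hx : 0 ≤ x) (hxy : x < y) (hy : y ≤ n) :
    coupOp n (fun a b => lyap (1296 * w ^ 2) w (b - a)) x y
      ≤ lyap (1296 * w ^ 2) w (y - x) - 1 := by
  have h := coupOp_lyap_le_aux hn (M := 1296 * w ^ 2) (by positivity) hw hx hxy hy
  have hD : (0 : ℝ) ≤ (y : ℝ) - x := by
    have : (x : ℝ) < y := by exact_mod_cast hxy
    linarith
  have hw0 : 0 < w := by linarith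
  have h2 := lyap_gain hw0 (z := ((y : ℝ) - x) / w) (by positivity)
  rw [mul_div_cancel₀ _ hw0.ne', hwn, ← div_pow] at h2
  linarith

/-- The probability that the coupled chains have not met by time `t`. -/
def notMet (n : ℕ) (t : ℕ) : ℤ → ℤ → ℝ :=
  (coupOp n)^[t] fun x y => if x < y then 1 else 0

lemma notMet_succ (t : ℕ) : notMet n (t + 1) = coupOp n (notMet n t) :=
  Function.iterate_succ_apply' _ _ _

lemma notMet_succ_le (hn : 0 < n) (t : ℕ) : ∀ x y : ℤ, 0 ≤ x → x ≤ y → y ≤ n →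
    notMet n (t + 1) x y ≤ notMet n t x y := by
  induction t with
  | zero =>
    intro x y hx _ hy
    have h1 := coupOp_mono hn (x := x) (y := y) (H := notMet n 0) (H' := fun _ _ => 1)
      (fun a b _ _ _ => by simp only [notMet, Function.iterate_zero, id]; split_ifs <;> norm_num)
      hx hy
    rw [notMet_succ]
    refine h1.trans (le_of_eq ?_)
    simp only [coupOp, notMet, Function.iterate_zero, id]
    split_ifs
    · ring
    · rfl
  | succ t ih =>
    intro x y hx _ hy
    simpa only [← notMet_succ] using coupOp_mono hn ih hx hy

lemma coupOp_add (H H' : ℤ → ℤ → ℝ) (x y : ℤ) :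
    coupOp n (fun a b => H a b + H' a b) x y = coupOp n H x y + coupOp n H' x y := by
  unfold coupOp
  split_ifs
  · ring
  · simp

lemma coupOp_sum (H : ℕ → ℤ → ℤ → ℝ) (T : ℕ) (x y : ℤ) :
    coupOp n (fun a b => ∑ s ∈ Finset.range T, H s a b) x y
      = ∑ s ∈ Finset.range T, coupOp n (H s) x y := by
  induction T with
  | zero => simp [coupOp]
  | succ T ih => simp only [Finset.sum_range_succ, coupOp_add, ih]

lemma sum_notMet_le (hn : 0 < n) {w : ℝ} (hw : 1 ≤ w) (hwn : w ^ 4 = n ^ 3) (T : ℕ) :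
    ∀ x y : ℤ, 0 ≤ x → x ≤ y → y ≤ n →
    ∑ s ∈ Finset.range T, notMet n s x y ≤ lyap (1296 * w ^ 2) w (y - x) := by
  induction T with
  | zero =>
    intro x y _ hxy _
    have : (x : ℝ) ≤ y := by exact_mod_cast hxy
    have : 0 ≤ (y : ℝ) - x := by linarith
    simp only [Finset.range_zero, Finset.sum_empty, lyap]
    positivity
  | succ T ih =>
    intro x y hx hxy hy
    rw [Finset.sum_range_succ']
    simp only [notMet_succ]
    rw [← coupOp_sum]
    rcases hxy.eq_or_lt with rfl | h
    · simp [coupOp, notMet, lyap]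
    · have h1 := coupOp_mono hn ih hx hy
      have h2 := coupOp_lyap_le hn hw hwn hx h hy
      have h3 : notMet n 0 x y = 1 := by simp [notMet, h]
      linarith

lemma mul_notMet_le (hn : 0 < n) {w : ℝ} (hw : 1 ≤ w) (hwn : w ^ 4 = n ^ 3) (T : ℕ)
    (hx : 0 ≤ x) (hxy : x ≤ y) (hy : y ≤ n) : T * notMet n T x y ≤ 1296 * w ^ 2 := by
  have hanti : Antitone fun s => notMet n s x y :=
    antitone_nat_of_succ_le fun s => notMet_succ_le hn s x y hx hxy hy
  have h1 : T * notMet n T x y ≤ ∑ s ∈ Finset.range T, notMet n s x y := by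
    rw [← nsmul_eq_mul]
    have := Finset.card_nsmul_le_sum (Finset.range T) (fun s => notMet n s x y) (notMet n T x y)
      fun s hs => hanti (Finset.mem_range.1 hs).le
    simpa using this
  refine (h1.trans (sum_notMet_le hn hw hwn T x y hx hxy hy)).trans ?_
  have : (x : ℝ) ≤ y := by exact_mod_cast hxy
  refine mul_le_of_le_one_right (by positivity) ((div_le_one (by linarith)).2 (by linarith))

lemma abs_magOp_iterate_sub_le (hn : 0 < n) {f : ℤ → ℝ} (hf : ∀ k, |f k| ≤ 1) (t : ℕ) :
    ∀ x y : ℤ, 0 ≤ x → x ≤ y → y ≤ n →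
    |(magOp n)^[t] f y - (magOp n)^[t] f x| ≤ notMet n t x y + notMet n t x y := by
  induction t with
  | zero =>
    intro x y _ hxy _
    rcases hxy.eq_or_lt with rfl | h
    · simp [notMet]
    · simp only [Function.iterate_zero, id, notMet, if_pos h]
      exact (abs_sub _ _).trans (add_le_add (hf y) (hf x))
  | succ t ih =>
    intro x y hx hxy hy
    rw [Function.iterate_succ_apply', notMet_succ, ← coupOp_add]
    exact abs_magOp_sub_le hn ih hx hxy hy

lemma mul_abs_magOp_iterate_sub_le (hn : 0 < n) {w : ℝ} (hw : 1 ≤ w) (hwn : w ^ 4 = n ^ 3)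
    {f : ℤ → ℝ} (hf : ∀ k, |f k| ≤ 1) (T : ℕ) (hx : 0 ≤ x) (hxn : x ≤ n) (hy : 0 ≤ y)
    (hyn : y ≤ n) : T * |(magOp n)^[T] f x - (magOp n)^[T] f y| ≤ 2592 * w ^ 2 := by
  wlog hxy : x ≤ y generalizing x y
  · rw [abs_sub_comm]
    exact this hy hyn hx hxn (by omega)
  rw [abs_sub_comm]
  have h1 := abs_magOp_iterate_sub_le hn hf T x y hx hxy hyn
  have h2 := mul_notMet_le hn hw hwn T hx hxy hyn
  have h3 : (0 : ℝ) ≤ T := by positivity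
  nlinarith [mul_le_mul_of_nonneg_left h1 h3]

end Coupling

/-! ### The dynamics acting on functions -/

/-- Number of plus spins. -/
def plusCount {n : ℕ} (σ : Config n) : ℤ := ∑ i, if σ i then 1 else 0

/-- The local field at site `i`, normalized. -/
def field {n : ℕ} (σ : Config n) (i : Fin n) : ℝ := mag σ - spin σ i / n

/-- Conditional expectation of `f` when the spin at site `i` is refreshed. -/
def siteOp {n : ℕ} (i : Fin n) (f : Config n → ℝ) (σ : Config n) : ℝ :=
  pPlus 1 (field σ i) * f (Function.update σ i true)
    + (1 - pPlus 1 (field σ i)) * f (Function.update σ i false)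

/-- Transition operator of the Glauber dynamics. -/
def glauberOp (n : ℕ) (f : Config n → ℝ) (σ : Config n) : ℝ :=
  ∑ η, glauberKernel 1 n σ η * f η

section Dynamics

variable {n : ℕ}

lemma spin_eq (σ : Config n) (i : Fin n) : spin σ i = 2 * (if σ i then 1 else 0) - 1 := by
  rw [spin]; split_ifs <;> norm_num

lemma sum_spin (σ : Config n) : ∑ i, spin σ i = 2 * plusCount σ - n := by
  simp only [spin_eq, Finset.sum_sub_distrib, ← Finset.mul_sum, plusCount]
  simp

lemma mag_eq (σ : Config n) : mag σ = magAt n (plusCount σ) := by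
  rw [mag, sum_spin, magAt]

lemma plusCount_nonneg (σ : Config n) : 0 ≤ plusCount σ :=
  Finset.sum_nonneg fun i _ => by split_ifs <;> norm_num

lemma plusCount_le (σ : Config n) : plusCount σ ≤ n := by
  calc plusCount σ ≤ ∑ _i : Fin n, (1 : ℤ) :=
        Finset.sum_le_sum fun i _ => by split_ifs <;> norm_num
    _ = n := by simp

lemma plusCount_update (σ : Config n) (i : Fin n) (b : Bool) :
    plusCount (Function.update σ i b)
      = plusCount σ + (if b then 1 else 0) - (if σ i then 1 else 0) := by
  have h : ∀ j, (if Function.update σ i b j then (1 : ℤ) else 0) = (if σ j then 1 else 0)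
      + if j = i then ((if b then 1 else 0) - (if σ i then 1 else 0)) else 0 := by
    intro j
    by_cases hj : j = i
    · subst hj; simp
    · simp [hj]
  rw [plusCount, Finset.sum_congr rfl fun j _ => h j, Finset.sum_add_distrib]
  simp [plusCount, add_sub_assoc]

lemma field_eq (σ : Config n) (i : Fin n) : field σ i = magAt n (plusCount σ) - spin σ i / n := by
  rw [field, mag_eq]

lemma field_congr {σ η : Config n} {i j : Fin n} (h : plusCount σ = plusCount η)
    (hij : σ i = η j) : field σ i = field η j := by
  rw [field_eq, field_eq, h, spin, spin, hij]

lemma field_update (σ : Config n) (i : Fin n) (b : Bool) :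
    field (Function.update σ i b) i = field σ i := by
  rw [field_eq, field_eq, plusCount_update, spin_eq, spin_eq, Function.update_self, magAt, magAt]
  push_cast
  ring

lemma siteOp_update (i : Fin n) (f : Config n → ℝ) (σ : Config n) (b : Bool) :
    siteOp i f (Function.update σ i b) = siteOp i f σ := by
  simp only [siteOp, field_update, Function.update_idem]

lemma glauberOp_eq (f : Config n → ℝ) (σ : Config n) :
    glauberOp n f σ = (1 / n) * ∑ i, siteOp i f σ := by
  simp only [glauberOp, glauberKernel, mul_assoc, ← Finset.mul_sum, Finset.sum_mul]
  rw [Finset.sum_comm]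
  congr 1
  refine Finset.sum_congr rfl fun i _ => ?_
  rw [Fintype.sum_eq_add (Function.update σ i true) (Function.update σ i false)]
  · have h : ∀ b, ∀ j, j ≠ i → Function.update σ i b j = σ j := fun b j hj => by simp [hj]
    rw [if_pos (h true), if_pos (h false)]
    simp [siteOp, field]
  · intro h
    simpa using congrFun h i
  · rintro η ⟨h1, h2⟩
    rw [if_neg, zero_mul]
    intro h
    have : ∀ b, η i = b → η = Function.update σ i b := fun b hb => by
      ext j
      by_cases hj : j = i
      · subst hj; simp [hb]
      · simp [hj, h j hj]
    cases hb : η i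
    · exact h2 (this _ hb)
    · exact h1 (this _ hb)

lemma siteOp_mono {f g : Config n → ℝ} (h : ∀ σ, f σ ≤ g σ) (i : Fin n) (σ : Config n) :
    siteOp i f σ ≤ siteOp i g σ :=
  add_le_add (mul_le_mul_of_nonneg_left (h _) (pPlus_pos _).le)
    (mul_le_mul_of_nonneg_left (h _) (sub_nonneg.2 (pPlus_lt_one _).le))

lemma glauberOp_mono {f g : Config n → ℝ} (h : ∀ σ, f σ ≤ g σ) (σ : Config n) :
    glauberOp n f σ ≤ glauberOp n g σ := by
  rw [glauberOp_eq, glauberOp_eq]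
  exact mul_le_mul_of_nonneg_left (Finset.sum_le_sum fun i _ => siteOp_mono h i σ) (by positivity)

lemma glauberOp_add_const (hn : 0 < n) (a c : ℝ) (f : Config n → ℝ) (σ : Config n) :
    glauberOp n (fun η => a * f η + c) σ = a * glauberOp n f σ + c := by
  have h : ∀ i, siteOp i (fun η => a * f η + c) σ = a * siteOp i f σ + c := fun i => by
    simp only [siteOp]; ring
  have : (n : ℝ) ≠ 0 := by positivity
  rw [glauberOp_eq, glauberOp_eq, Finset.sum_congr rfl fun i _ => h i, Finset.sum_add_distrib,
    ← Finset.mul_sum, Finset.sum_const, Finset.card_univ, Fintype.card_fin, nsmul_eq_mul]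
  field_simp

lemma glauberOp_iterate_mono {f g : Config n → ℝ} (h : ∀ σ, f σ ≤ g σ) (t : ℕ) :
    ∀ σ, (glauberOp n)^[t] f σ ≤ (glauberOp n)^[t] g σ := by
  induction t with
  | zero => exact h
  | succ t ih =>
    intro σ
    rw [Function.iterate_succ_apply', Function.iterate_succ_apply']
    exact glauberOp_mono ih σ

lemma glauberOp_iterate_add_const (hn : 0 < n) (a c : ℝ) (f : Config n → ℝ) (t : ℕ) :
    (glauberOp n)^[t] (fun η => a * f η + c) = fun σ => a * (glauberOp n)^[t] f σ + c := by
  induction t with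
  | zero => rfl
  | succ t ih =>
    rw [Function.iterate_succ_apply', ih, Function.iterate_succ_apply']
    exact funext fun σ => glauberOp_add_const hn a c _ σ

lemma abs_glauberOp_iterate_sub_le (hn : 0 < n) {f g : Config n → ℝ} {ε : ℝ}
    (h : ∀ σ, |f σ - g σ| ≤ ε) (t : ℕ) (σ : Config n) :
    |(glauberOp n)^[t] f σ - (glauberOp n)^[t] g σ| ≤ ε := by
  have h1 := glauberOp_iterate_mono (f := f) (g := fun η => 1 * g η + ε)
    (fun η => by linarith [(abs_le.1 (h η)).2]) t σ
  have h2 := glauberOp_iterate_mono (f := fun η => 1 * g η + -ε) (g := f)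
    (fun η => by linarith [(abs_le.1 (h η)).1]) t σ
  rw [glauberOp_iterate_add_const hn] at h1 h2
  rw [abs_le]
  constructor <;> linarith

lemma abs_glauberOp_iterate_le (hn : 0 < n) {f : Config n → ℝ} {ε : ℝ}
    (h : ∀ σ, |f σ| ≤ ε) (t : ℕ) (σ : Config n) : |(glauberOp n)^[t] f σ| ≤ ε := by
  have h1 := glauberOp_iterate_mono (f := f) (g := fun η => 0 * f η + ε)
    (fun η => by linarith [(abs_le.1 (h η)).2]) t σ
  have h2 := glauberOp_iterate_mono (f := fun η => 0 * f η + -ε) (g := f)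
    (fun η => by linarith [(abs_le.1 (h η)).1]) t σ
  rw [glauberOp_iterate_add_const hn] at h1 h2
  rw [abs_le]
  constructor <;> linarith

lemma glauberOp_comp_plusCount (hn : 0 < n) (f : ℤ → ℝ) (σ : Config n) :
    glauberOp n (fun η => f (plusCount η)) σ = magOp n f (plusCount σ) := by
  set k := plusCount σ with hk
  have h : ∀ i, siteOp i (fun η => f (plusCount η)) σ = f k
      + pPlus 1 (magAt n k + 1 / n) * (f (k + 1) - f k)
      + ((1 - pPlus 1 (magAt n k - 1 / n)) * (f (k - 1) - f k)
        - pPlus 1 (magAt n k + 1 / n) * (f (k + 1) - f k)) * ((if σ i then 1 else 0 : ℤ) : ℝ) := by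
    intro i
    simp only [siteOp, plusCount_update, field_eq, ← hk, spin]
    cases hi : σ i
    · simp only [Bool.false_eq_true, if_false, if_true, neg_div, sub_neg_eq_add]
      simp
      ring
    · simp only [Bool.false_eq_true, if_false, if_true]
      simp
      ring
  have hs : ∑ i, (((if σ i then 1 else 0 : ℤ)) : ℝ) = k := by
    rw [hk, plusCount, Int.cast_sum]
  have : (n : ℝ) ≠ 0 := by positivity
  rw [glauberOp_eq, Finset.sum_congr rfl fun i _ => h i, Finset.sum_add_distrib, ← Finset.mul_sum,
    hs, Finset.sum_const, Finset.card_univ, Fintype.card_fin, nsmul_eq_mul, magOp, birthRate,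
    deathRate]
  field_simp
  ring

lemma glauberOp_iterate_comp_plusCount (hn : 0 < n) (f : ℤ → ℝ) (t : ℕ) :
    (glauberOp n)^[t] (fun η => f (plusCount η)) = fun σ => (magOp n)^[t] f (plusCount σ) := by
  induction t with
  | zero => rfl
  | succ t ih =>
    rw [Function.iterate_succ_apply', ih, Function.iterate_succ_apply']
    exact funext fun σ => glauberOp_comp_plusCount hn _ σ

lemma sum_glauberLaw_mul (t : ℕ) (σ : Config n) (f : Config n → ℝ) :
    ∑ η, glauberLaw 1 n t σ η * f η = (glauberOp n)^[t] f σ := by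
  induction t generalizing f with
  | zero => simp [glauberLaw]
  | succ t ih =>
    rw [Function.iterate_succ_apply, ← ih]
    simp only [glauberLaw, glauberOp, Finset.sum_mul, Finset.mul_sum]
    rw [Finset.sum_comm]
    simp only [mul_assoc]

end Dynamics

/-! ### Configurations with the same magnetization -/

section Swap

variable {n : ℕ}

/-- `f` changes by at most `L` when a plus spin is moved to another site. -/
def MoveLipschitz (L : ℝ) (f : Config n → ℝ) : Prop :=
  ∀ (τ : Config n) (i j : Fin n), i ≠ j → τ i = false → τ j = false →
    |f (Function.update τ i true) - f (Function.update τ j true)| ≤ L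

lemma abs_mix_sub_mix_le {p a b a' b' L K : ℝ} (hp0 : 0 ≤ p) (hp1 : p ≤ 1) (ha : |a - a'| ≤ L)
    (hb : |b - b'| ≤ K) :
    |(p * a + (1 - p) * b) - (p * a' + (1 - p) * b')| ≤ p * L + (1 - p) * K := by
  have e : (p * a + (1 - p) * b) - (p * a' + (1 - p) * b')
      = p * (a - a') + (1 - p) * (b - b') := by ring
  rw [e]
  refine (abs_add_le _ _).trans (add_le_add ?_ ?_)
  · rw [abs_mul, abs_of_nonneg hp0]
    exact mul_le_mul_of_nonneg_left ha hp0
  · rw [abs_mul, abs_of_nonneg (by linarith : 0 ≤ 1 - p)]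
    exact mul_le_mul_of_nonneg_left hb (by linarith)

lemma MoveLipschitz.glauberOp (hn : 0 < n) {L : ℝ} (hL : 0 ≤ L) {f : Config n → ℝ}
    (hf : MoveLipschitz L f) : MoveLipschitz ((1 - 1 / (9 * n)) * L) (glauberOp n f) := by
  intro τ i j hij hi hj
  have hji := hij.symm
  have hK : plusCount (Function.update τ i true) = plusCount (Function.update τ j true) := by
    simp [plusCount_update, hi, hj]
  have hk : ∀ k, |siteOp k f (Function.update τ i true)
      - siteOp (Equiv.swap i j k) f (Function.update τ j true)|
      ≤ L - if k = i then L / 9 else 0 := by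
    intro k
    by_cases hki : k = i
    · subst hki
      have hfield : field (Function.update τ j true) j = field (Function.update τ k true) k :=
        field_congr hK.symm (by simp)
      have hp := pPlus_le_eight_ninths (s := field (Function.update τ k true) k) (by
        have := (magAt_mem_Icc hn (plusCount_nonneg (Function.update τ k true))
          (plusCount_le _)).2
        have h1 : (0 : ℝ) ≤ 1 / n := by positivity
        rw [field_eq, spin, Function.update_self, if_pos rfl]
        linarith)
      have h1 : Function.update τ k false = τ := by rw [← hi, Function.update_eq_self]
      have h2 : Function.update τ j false = τ := by rw [← hj, Function.update_eq_self]
      rw [Equiv.swap_apply_left, siteOp, siteOp, hfield, if_pos rfl]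
      simp only [Function.update_idem, h1, h2]
      refine (abs_mix_sub_mix_le (K := 0) (pPlus_pos _).le (pPlus_lt_one _).le
        (hf τ k j hij hi hj) (by simp)).trans ?_
      nlinarith
    rw [if_neg hki, sub_zero]
    by_cases hkj : k = j
    · subst hkj
      have hfield : field (Function.update τ k true) i = field (Function.update τ i true) k :=
        field_congr hK.symm (by simp [hi, hj, hij, hji])
      have h1 : Function.update (Function.update τ i true) k false = Function.update τ i true := by
        rw [Function.update_comm hij, ← hj, Function.update_eq_self]
      have h2 : Function.update (Function.update τ k true) i false = Function.update τ k true := by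
        rw [Function.update_comm hji, ← hi, Function.update_eq_self]
      rw [Equiv.swap_apply_right, siteOp, siteOp, hfield, h1, h2, Function.update_comm hji]
      refine (abs_mix_sub_mix_le (L := 0) (pPlus_pos _).le (pPlus_lt_one _).le
        (by simp) (hf τ i k hij hi hj)).trans ?_
      nlinarith [mul_nonneg (pPlus_pos (field (Function.update τ i true) k)).le hL]
    · have hfield : field (Function.update τ j true) k = field (Function.update τ i true) k :=
        field_congr hK.symm (by simp [hki, hkj])
      have h1 : ∀ b, |f (Function.update (Function.update τ i true) k b)
          - f (Function.update (Function.update τ j true) k b)| ≤ L := fun b => by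
        rw [Function.update_comm (Ne.symm hki), Function.update_comm (Ne.symm hkj)]
        exact hf _ i j hij (by simp [Ne.symm hki, hi]) (by simp [Ne.symm hkj, hj])
      rw [Equiv.swap_apply_of_ne_of_ne hki hkj, siteOp, siteOp, hfield]
      exact (abs_mix_sub_mix_le (pPlus_pos _).le (pPlus_lt_one _).le (h1 _) (h1 _)).trans
        (by linarith)
  have h0 : (0 : ℝ) < n := by positivity
  rw [glauberOp_eq, glauberOp_eq, ← Equiv.sum_comp (Equiv.swap i j)
    (fun k => siteOp k f (Function.update τ j true)), ← mul_sub, ← Finset.sum_sub_distrib, abs_mul,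
    abs_of_pos (by positivity)]
  calc 1 / (n : ℝ) * |∑ k, (siteOp k f (Function.update τ i true)
        - siteOp (Equiv.swap i j k) f (Function.update τ j true))|
      ≤ 1 / n * ∑ k, (L - if k = i then L / 9 else 0) :=
        mul_le_mul_of_nonneg_left ((Finset.abs_sum_le_sum_abs _ _).trans
          (Finset.sum_le_sum fun k _ => hk k)) (by positivity)
    _ = (1 - 1 / (9 * n)) * L := by
        rw [Finset.sum_sub_distrib]
        simp
        field_simp

lemma MoveLipschitz.glauberOp_iterate (hn : 0 < n) {L : ℝ} (hL : 0 ≤ L) {f : Config n → ℝ}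
    (hf : MoveLipschitz L f) (t : ℕ) :
    MoveLipschitz ((1 - 1 / (9 * n)) ^ t * L) ((CW.glauberOp n)^[t] f) := by
  have h1 : (0 : ℝ) ≤ 1 - 1 / (9 * n) := by
    have : (1 : ℝ) ≤ n := by exact_mod_cast hn
    rw [sub_nonneg, div_le_one (by positivity)]
    linarith
  induction t with
  | zero => simpa using hf
  | succ t ih =>
    rw [Function.iterate_succ_apply', pow_succ', mul_assoc]
    exact ih.glauberOp hn (by positivity)

lemma MoveLipschitz.abs_sub_le {L : ℝ} (hL : 0 ≤ L) {f : Config n → ℝ} (hf : MoveLipschitz L f)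
    (m : ℕ) : ∀ σ η : Config n, plusCount σ = plusCount η →
      (Finset.univ.filter fun i => σ i ≠ η i).card ≤ m → |f σ - f η| ≤ m * L := by
  induction m with
  | zero =>
    intro σ η _ hc
    have : σ = η := funext fun i => by
      by_contra h
      have : i ∈ Finset.univ.filter fun i => σ i ≠ η i := by simp [h]
      simp [Finset.card_eq_zero.1 (Nat.le_zero.1 hc)] at this
    simp [this]
  | succ m ih =>
    intro σ η hK hc
    by_cases hne : σ = η
    · simp only [hne, sub_self, abs_zero]; positivity
    have hlt : ∀ σ η : Config n, plusCount σ = plusCount η → σ ≠ η →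
        ∃ i, σ i = true ∧ η i = false := by
      intro σ η hK hne
      by_contra! h
      apply hne
      have hle : ∀ i ∈ Finset.univ, (if σ i then (1 : ℤ) else 0) ≤ if η i then 1 else 0 := by
        intro i _
        have := h i
        cases hσ : σ i <;> cases hη : η i <;> simp_all
      have := (Finset.sum_eq_sum_iff_of_le hle).1 hK
      funext i
      have := this i (Finset.mem_univ i)
      cases hσ : σ i <;> cases hη : η i <;> simp_all
    obtain ⟨i, hi, hi'⟩ := hlt σ η hK hne
    obtain ⟨j, hj, hj'⟩ := hlt η σ hK.symm (Ne.symm hne)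
    have hij : i ≠ j := by rintro rfl; simp_all
    set τ := Function.update σ i false with hτ
    have hσ : σ = Function.update τ i true := by
      rw [hτ, Function.update_idem, ← hi, Function.update_eq_self]
    have hτj : τ j = false := by simp [hτ, hij.symm, hj']
    have h1 := hf τ i j hij (by simp [hτ]) hτj
    have h2 := ih (Function.update τ j true) η (by
      rw [← hK, plusCount_update, hτj, hτ, plusCount_update, hi]; simp) (by
      have hsub : (Finset.univ.filter fun k => Function.update τ j true k ≠ η k) ⊂
          (Finset.univ.filter fun k => σ k ≠ η k) := by
        rw [Finset.ssubset_iff_of_subset]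
        · exact ⟨i, by simp [hi, hi'], by simp [hij, hτ, hi']⟩
        · intro k
          simp only [Finset.mem_filter, Finset.mem_univ, true_and]
          by_cases hkj : k = j
          · subst hkj; simp [hj]
          · by_cases hki : k = i
            · subst hki; simp [hi, hi']
            · simp [hkj, hki, hτ]
      have := Finset.card_lt_card hsub
      omega)
    rw [← hσ] at h1
    calc |f σ - f η|
        ≤ |f σ - f (Function.update τ j true)| + |f (Function.update τ j true) - f η| :=
          _root_.abs_sub_le _ _ _
      _ ≤ L + m * L := add_le_add h1 h2
      _ = (m + 1 : ℕ) * L := by push_cast; ring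

lemma abs_glauberOp_iterate_sub_le_of_plusCount_eq (hn : 0 < n) {f : Config n → ℝ}
    (hf : ∀ σ, |f σ| ≤ 1) (t : ℕ) {σ η : Config n} (h : plusCount σ = plusCount η) :
    |(glauberOp n)^[t] f σ - (glauberOp n)^[t] f η| ≤ n * ((1 - 1 / (9 * n)) ^ t * 2) := by
  have h1 : (0 : ℝ) ≤ 1 - 1 / (9 * n) := by
    have : (1 : ℝ) ≤ n := by exact_mod_cast hn
    rw [sub_nonneg, div_le_one (by positivity)]
    linarith
  have hM : MoveLipschitz 2 f := fun τ i j _ _ _ =>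
    (abs_sub _ _).trans (by linarith [hf (Function.update τ i true), hf (Function.update τ j true)])
  refine (hM.glauberOp_iterate hn (by norm_num) t).abs_sub_le (by positivity) n σ η h ?_
  exact (Finset.card_le_univ _).trans (by simp)

end Swap

/-! ### The Curie-Weiss measure -/

section Measure

variable {n : ℕ}

lemma cwExponent_eq (σ : Config n) :
    cwExponent 1 σ = ((2 * plusCount σ - n) ^ 2 - n) / (2 * n) := by
  have hsq : (∑ i, spin σ i) ^ 2
      = 2 * (∑ i, ∑ j, if i < j then spin σ i * spin σ j else 0) + n := by
    have h1 : ∀ i j : Fin n, spin σ i * spin σ j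
        = (if i < j then spin σ i * spin σ j else 0) + (if j < i then spin σ j * spin σ i else 0)
          + (if j = i then 1 else 0) := by
      intro i j
      rcases lt_trichotomy i j with h | h | h
      · simp [h, h.not_gt, h.ne']
      · subst h
        simp only [lt_self_iff_false, if_false, if_true, spin]
        split_ifs <;> norm_num
      · simp [h, h.not_gt, h.ne, mul_comm]
    have h2 : ∑ i, ∑ j, (if j < i then spin σ j * spin σ i else 0)
        = ∑ i, ∑ j, if i < j then spin σ i * spin σ j else 0 := Finset.sum_comm
    rw [sq, Finset.sum_mul_sum,
      Finset.sum_congr rfl fun i _ => Finset.sum_congr rfl fun j _ => h1 i j]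
    simp only [Finset.sum_add_distrib]
    rw [h2]
    simp
    ring
  rw [← sum_spin, hsq, cwExponent]
  by_cases hn : (n : ℝ) = 0
  · simp [hn]
  · field_simp
    ring

lemma partition_pos : 0 < ∑ η : Config n, Real.exp (cwExponent 1 η) :=
  Finset.sum_pos (fun _ _ => Real.exp_pos _) Finset.univ_nonempty

lemma cwMeasure_nonneg (σ : Config n) : 0 ≤ cwMeasure 1 n σ :=
  div_nonneg (Real.exp_pos _).le partition_pos.le

lemma sum_cwMeasure : ∑ σ, cwMeasure 1 n σ = 1 := by
  simp only [cwMeasure, ← Finset.sum_div]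
  exact div_self partition_pos.ne'

lemma cwMeasure_detailed_balance (hn : 0 < n) (σ : Config n) (i : Fin n) :
    cwMeasure 1 n (Function.update σ i true) * (1 - pPlus 1 (field σ i))
      = cwMeasure 1 n (Function.update σ i false) * pPlus 1 (field σ i) := by
  have h0 : (n : ℝ) ≠ 0 := by positivity
  have hE : cwExponent 1 (Function.update σ i false)
      = cwExponent 1 (Function.update σ i true) + -(2 * field σ i) := by
    rw [cwExponent_eq, cwExponent_eq, plusCount_update, plusCount_update, field_eq, spin_eq, magAt]
    push_cast
    simp only [if_true]
    field_simp
    ring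
  have := Real.exp_pos (-(2 * field σ i))
  rw [cwMeasure, cwMeasure, hE, Real.exp_add, pPlus_eq]
  field_simp
  ring

lemma sum_cwMeasure_mul_siteOp (hn : 0 < n) (f : Config n → ℝ) (i : Fin n) :
    ∑ σ, cwMeasure 1 n σ * siteOp i f σ = ∑ σ, cwMeasure 1 n σ * f σ := by
  have hinv : Function.Involutive fun σ : Config n => Function.update σ i (!σ i) := fun σ => by
    simp
  have hpair : ∀ F : Config n → ℝ,
      2 * ∑ σ, F σ = ∑ σ, (F (Function.update σ i true) + F (Function.update σ i false)) := by
    intro F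
    have h := Equiv.sum_comp hinv.toPerm F
    rw [two_mul]
    nth_rw 2 [← h]
    rw [← Finset.sum_add_distrib]
    refine Finset.sum_congr rfl fun σ _ => ?_
    simp only [Function.Involutive.coe_toPerm]
    cases hσ : σ i
    · have : Function.update σ i false = σ := by rw [← hσ, Function.update_eq_self]
      rw [this, add_comm]; rfl
    · have : Function.update σ i true = σ := by rw [← hσ, Function.update_eq_self]
      rw [this]; rfl
  suffices 2 * ∑ σ, cwMeasure 1 n σ * siteOp i f σ = 2 * ∑ σ, cwMeasure 1 n σ * f σ by linarith
  rw [hpair, hpair]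
  refine Finset.sum_congr rfl fun σ _ => ?_
  have h := cwMeasure_detailed_balance hn σ i
  simp only [siteOp_update]
  rw [siteOp]
  linear_combination (f (Function.update σ i false) - f (Function.update σ i true)) * h

lemma sum_cwMeasure_mul_glauberOp (hn : 0 < n) (f : Config n → ℝ) :
    ∑ σ, cwMeasure 1 n σ * glauberOp n f σ = ∑ σ, cwMeasure 1 n σ * f σ := by
  have h0 : (n : ℝ) ≠ 0 := by positivity
  simp only [glauberOp_eq]
  calc ∑ σ, cwMeasure 1 n σ * (1 / n * ∑ i, siteOp i f σ)
      = 1 / n * ∑ i, ∑ σ, cwMeasure 1 n σ * siteOp i f σ := by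
        rw [Finset.sum_comm, Finset.mul_sum]
        refine Finset.sum_congr rfl fun σ _ => ?_
        rw [← Finset.mul_sum]
        ring
    _ = _ := by
        simp only [sum_cwMeasure_mul_siteOp hn, Finset.sum_const, Finset.card_univ,
          Fintype.card_fin, nsmul_eq_mul]
        field_simp

lemma sum_cwMeasure_mul_glauberOp_iterate (hn : 0 < n) (f : Config n → ℝ) (t : ℕ) :
    ∑ σ, cwMeasure 1 n σ * (glauberOp n)^[t] f σ = ∑ σ, cwMeasure 1 n σ * f σ := by
  induction t with
  | zero => rfl
  | succ t ih => simp only [Function.iterate_succ_apply', sum_cwMeasure_mul_glauberOp hn, ih]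

lemma plusCount_not (σ : Config n) : plusCount (fun i => !σ i) = n - plusCount σ := by
  have h : ∀ i, (if (!σ i) = true then (1 : ℤ) else 0) = 1 - if σ i then 1 else 0 := fun i => by
    cases σ i <;> simp
  simp only [plusCount, h, Finset.sum_sub_distrib]
  simp

lemma sum_cwMeasure_mul_eq_zero {f : Config n → ℝ} (hf : ∀ σ, f (fun i => !σ i) = -f σ) :
    ∑ σ, cwMeasure 1 n σ * f σ = 0 := by
  have hinv : Function.Involutive fun (σ : Config n) i => !σ i := fun σ => by simp
  have hμ : ∀ σ : Config n, cwMeasure 1 n (fun i => !σ i) = cwMeasure 1 n σ := fun σ => by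
    rw [cwMeasure, cwMeasure, cwExponent_eq, cwExponent_eq, plusCount_not]
    push_cast
    ring_nf
  have h := Equiv.sum_comp hinv.toPerm fun σ => cwMeasure 1 n σ * f σ
  simp only [Function.Involutive.coe_toPerm, hf, hμ, mul_neg, Finset.sum_neg_distrib] at h
  linarith

end Measure

/-! ### Total variation distance -/

section TotalVariation

variable {Ω : Type*} [Fintype Ω]

lemma tvDist_le_of_forall {μ ν : Ω → ℝ} {ε : ℝ}
    (h : ∀ f : Ω → ℝ, (∀ x, |f x| ≤ 1) → ∑ x, μ x * f x - ∑ x, ν x * f x ≤ 2 * ε) :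
    tvDist μ ν ≤ ε := by
  have h1 := h (fun x => if 0 ≤ μ x - ν x then 1 else -1) fun x => by split_ifs <;> simp
  have h2 : ∑ x, |μ x - ν x| = ∑ x, μ x * (if 0 ≤ μ x - ν x then 1 else -1)
      - ∑ x, ν x * (if 0 ≤ μ x - ν x then 1 else -1) := by
    rw [← Finset.sum_sub_distrib]
    refine Finset.sum_congr rfl fun x _ => ?_
    split_ifs with hx
    · rw [abs_of_nonneg hx]; ring
    · rw [abs_of_neg (not_le.1 hx)]; ring
  rw [tvDist, h2]
  linarith

lemma sum_mul_sub_sum_mul_le (μ ν : Ω → ℝ) {f : Ω → ℝ} (hf : ∀ x, |f x| ≤ 1) :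
    ∑ x, μ x * f x - ∑ x, ν x * f x ≤ 2 * tvDist μ ν := by
  have h : ∑ x, μ x * f x - ∑ x, ν x * f x ≤ ∑ x, |μ x - ν x| := by
    rw [← Finset.sum_sub_distrib]
    refine Finset.sum_le_sum fun x _ => ?_
    rw [← sub_mul]
    refine (le_abs_self _).trans ?_
    rw [abs_mul]
    exact mul_le_of_le_one_right (abs_nonneg _) (hf x)
  rw [tvDist]
  linarith

end TotalVariation

/-! ### Upper bound -/

section UpperBound

variable {n : ℕ}

lemma mul_abs_glauberOp_iterate_sub_le (hn : 0 < n) {w : ℝ} (hw : 1 ≤ w) (hwn : w ^ 4 = n ^ 3)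
    {g : Config n → ℝ} (hg : ∀ σ, |g σ| ≤ 1) {ε : ℝ}
    (hε : ∀ σ η, plusCount σ = plusCount η → |g σ - g η| ≤ ε) {T : ℕ} (hT : 0 < T)
    (σ η : Config n) :
    |(glauberOp n)^[T] g σ - (glauberOp n)^[T] g η| ≤ 2 * ε + 2592 * w ^ 2 / T := by
  classical
  let f : ℤ → ℝ := fun k => if h : ∃ σ : Config n, plusCount σ = k then g h.choose else 0
  have hf : ∀ k, |f k| ≤ 1 := fun k => by
    simp only [f]
    split_ifs with h
    · exact hg _
    · simp
  have hfg : ∀ σ, |g σ - f (plusCount σ)| ≤ ε := fun σ => by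
    have h : ∃ τ : Config n, plusCount τ = plusCount σ := ⟨σ, rfl⟩
    simp only [f, dif_pos h]
    exact hε _ _ h.choose_spec.symm
  have h1 := abs_glauberOp_iterate_sub_le hn hfg T σ
  have h2 := abs_glauberOp_iterate_sub_le hn hfg T η
  have h3 := mul_abs_magOp_iterate_sub_le hn hw hwn hf T (plusCount_nonneg σ) (plusCount_le σ)
    (plusCount_nonneg η) (plusCount_le η)
  rw [← le_div_iff₀' (by exact_mod_cast hT)] at h3
  rw [glauberOp_iterate_comp_plusCount hn] at h1 h2
  rw [abs_le] at *
  constructor <;> linarith [h1.1, h1.2, h2.1, h2.2, h3.1, h3.2]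

lemma geometric_le (hn : 0 < n) {w : ℝ} (hwn : w ^ 4 = n ^ 3) {T : ℕ}
    (hT : 10368 * w ^ 2 ≤ T) : n * ((1 - 1 / (9 * n)) ^ T * 2) ≤ (1 / 8 : ℝ) := by
  have h1 : (1 : ℝ) ≤ n := by exact_mod_cast hn
  have h0 : (0 : ℝ) < n := by linarith
  set z : ℝ := T / (9 * n) with hz
  have hz0 : 0 ≤ z := by positivity
  have hpow : (1 - 1 / (9 * n) : ℝ) ^ T ≤ Real.exp (-z) := by
    have h2 : (0 : ℝ) ≤ 1 - 1 / (9 * n) := by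
      rw [sub_nonneg, div_le_one (by positivity)]
      linarith
    have h3 : (1 - 1 / (9 * n) : ℝ) ≤ Real.exp (-(1 / (9 * n))) := by
      linarith [Real.add_one_le_exp (-(1 / (9 * (n : ℝ))))]
    refine (pow_le_pow_left₀ h2 h3 T).trans (le_of_eq ?_)
    rw [← Real.exp_nat_mul, hz]
    congr 1
    ring
  have hzw : 1152 * (w ^ 2 / n) ≤ z := by
    rw [hz, le_div_iff₀ (by positivity)]
    field_simp
    linarith
  have hz2 : 1152 ^ 2 * n ≤ z ^ 2 := by
    have h4 := pow_le_pow_left₀ (by positivity) hzw 2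
    have h5 : (1152 * (w ^ 2 / n)) ^ 2 = 1152 ^ 2 * (n : ℝ) := by
      rw [mul_pow, div_pow, ← pow_mul, hwn]
      field_simp
    linarith
  have hexp := Real.quadratic_le_exp_of_nonneg hz0
  have h6 : Real.exp (-z) * Real.exp z = 1 := by rw [← Real.exp_add]; simp
  have h7 := Real.exp_pos (-z)
  have h8 : 16 * (n : ℝ) ≤ Real.exp z := by nlinarith
  have h9 : Real.exp (-z) * (16 * n) ≤ 1 := h6 ▸ mul_le_mul_of_nonneg_left h8 h7.le
  nlinarith [mul_le_mul_of_nonneg_left hpow h0.le]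

lemma glauberDist_le (hn : 0 < n) {w : ℝ} (hw : 1 ≤ w) (hwn : w ^ 4 = n ^ 3) {T : ℕ}
    (hT : 10368 * w ^ 2 ≤ T) : glauberDist 1 n (T + T) ≤ 1 / 4 := by
  have hT0 : (0 : ℝ) < T := lt_of_lt_of_le (by positivity) hT
  refine ciSup_le fun σ => tvDist_le_of_forall fun f hf => ?_
  rw [sum_glauberLaw_mul, ← sum_cwMeasure_mul_glauberOp_iterate hn f (T + T)]
  have key : ∀ η, (glauberOp n)^[T + T] f σ - (glauberOp n)^[T + T] f η ≤ 1 / 2 := fun η => by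
    rw [Function.iterate_add_apply]
    have h1 := mul_abs_glauberOp_iterate_sub_le hn hw hwn (abs_glauberOp_iterate_le hn hf T)
      (fun σ η h => abs_glauberOp_iterate_sub_le_of_plusCount_eq hn hf T h)
      (by exact_mod_cast hT0) σ η
    have h2 := geometric_le hn hwn hT
    have h3 : 2592 * w ^ 2 / T ≤ 1 / 4 := by
      rw [div_le_iff₀ hT0]; linarith
    linarith [le_abs_self ((glauberOp n)^[T] ((glauberOp n)^[T] f) σ
      - (glauberOp n)^[T] ((glauberOp n)^[T] f) η)]
  calc (glauberOp n)^[T + T] f σ - ∑ η, cwMeasure 1 n η * (glauberOp n)^[T + T] f η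
      = ∑ η, cwMeasure 1 n η * ((glauberOp n)^[T + T] f σ - (glauberOp n)^[T + T] f η) := by
        simp only [mul_sub, Finset.sum_sub_distrib, ← Finset.sum_mul, sum_cwMeasure, one_mul]
    _ ≤ ∑ η, cwMeasure 1 n η * (1 / 2) :=
        Finset.sum_le_sum fun η _ => mul_le_mul_of_nonneg_left (key η) (cwMeasure_nonneg η)
    _ = 2 * (1 / 4) := by
        rw [← Finset.sum_mul, sum_cwMeasure]; norm_num

end UpperBound

/-! ### Lower bound -/

section LowerBound

variable {n : ℕ}

lemma exists_plusCount_eq {k : ℤ} (hk : 0 ≤ k) (hkn : k ≤ n) :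
    ∃ σ : Config n, plusCount σ = k := by
  obtain ⟨s, _, hs⟩ := Finset.exists_subset_card_eq (s := (Finset.univ : Finset (Fin n)))
    (n := k.toNat) (by simp; omega)
  refine ⟨fun i => decide (i ∈ s), ?_⟩
  simp [plusCount, hs, hk]

lemma sub_mul_drift_le {ε s s₀ : ℝ} (hε : 0 ≤ ε) (hs : s ∈ Set.Icc (-1 : ℝ) 1) (hs₀ : 0 ≤ s₀)
    (hs₀1 : s₀ ≤ 1) : (s - s₀) * drift ε s ≤ s₀ * (2 * s₀ ^ 3 + 2 * ε) := by
  have hanti : ∀ {a b : ℝ}, -1 ≤ a → a ≤ b → b ≤ 1 → drift ε b ≤ drift ε a := by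
    intro a b ha hab hb
    have := drift_sub_le hε ha hab hb
    have : 0 ≤ (b - a) ^ 3 := pow_nonneg (sub_nonneg.2 hab) 3
    linarith
  have h0 : drift ε 0 = 0 := by
    have := drift_neg ε 0
    rw [neg_zero] at this
    linarith
  have hR : 0 ≤ s₀ * (2 * s₀ ^ 3 + 2 * ε) := by positivity
  rcases le_total s 0 with h | h
  · have h1 := hanti hs.1 h zero_le_one
    have := mul_nonneg (show 0 ≤ s₀ - s by linarith) (h0 ▸ h1)
    linarith
  have h1 := hanti (by norm_num) h hs.2
  rw [h0] at h1
  rcases le_total s s₀ with h2 | h2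
  · have h3 := hanti hs.1 h2 hs₀1
    have h4 := neg_le_drift hε hs₀ hs₀1
    have h5 : -drift ε s ≤ 2 * s₀ ^ 3 + 2 * ε := by linarith
    have h6 := mul_le_mul (show s₀ - s ≤ s₀ by linarith) h5 (by linarith) hs₀
    linarith
  · have := mul_nonneg (show 0 ≤ s - s₀ by linarith) (neg_nonneg.2 h1)
    linarith

lemma magOp_sq_le (hn : 0 < n) {w m₀ : ℝ} (hwn : w ^ 4 = n ^ 3)
    (hm : 0 ≤ m₀) (hm3 : m₀ ≤ 3 * w) (hmn : m₀ ≤ n) {k : ℤ} (hk : 0 ≤ k) (hkn : k ≤ n) :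
    magOp n (fun j => (2 * j - n - m₀) ^ 2) k ≤ (2 * k - n - m₀) ^ 2 + 168 := by
  have h0 : (0 : ℝ) < n := by positivity
  have hs₀1 : m₀ / n ≤ 1 := (div_le_one h0).2 hmn
  have h1 := sub_mul_drift_le (ε := 1 / n) (s₀ := m₀ / n) (by positivity)
    (magAt_mem_Icc hn hk hkn) (by positivity) hs₀1
  have h2 := birthRate_add_deathRate_le hn hk hkn
  have e : magOp n (fun j => (2 * j - n - m₀) ^ 2) k = (2 * k - n - m₀) ^ 2
      + 4 * (2 * k - n - m₀) * (birthRate n k - deathRate n k)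
      + 4 * (birthRate n k + deathRate n k) := by
    simp only [magOp]
    push_cast
    ring
  have e2 : (2 * k - n - m₀ : ℝ) = n * (magAt n k - m₀ / n) := by
    rw [magAt]; field_simp
  have h3 : n * ((m₀ / n) * (2 * (m₀ / n) ^ 3 + 2 * (1 / n))) ≤ 164 := by
    have h4 : m₀ ^ 4 ≤ 81 * n ^ 3 := by
      have := pow_le_pow_left₀ hm hm3 4
      rw [mul_pow, hwn] at this
      linarith
    have e3 : n * ((m₀ / n) * (2 * (m₀ / n) ^ 3 + 2 * (1 / n)))
        = 2 * (m₀ ^ 4 / n ^ 3) + 2 * (m₀ / n) := by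
      field_simp
    have h5 : m₀ ^ 4 / n ^ 3 ≤ 81 := (div_le_iff₀ (by positivity)).2 h4
    linarith
  have h6 := mul_le_mul_of_nonneg_left h1 h0.le
  have h7 : 4 * (2 * k - n - m₀) * (birthRate n k - deathRate n k)
      = n * ((magAt n k - m₀ / n) * drift (1 / n) (magAt n k)) := by
    rw [birthRate_sub_deathRate n k hn, e2]; ring
  rw [e, h7]
  linarith

lemma glauberOp_iterate_sq_le (hn : 0 < n) {w m₀ : ℝ} (hwn : w ^ 4 = n ^ 3)
    (hm : 0 ≤ m₀) (hm3 : m₀ ≤ 3 * w) (hmn : m₀ ≤ n) (t : ℕ) (σ : Config n) :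
    (glauberOp n)^[t] (fun η => (2 * plusCount η - n - m₀) ^ 2) σ
      ≤ (2 * plusCount σ - n - m₀) ^ 2 + 168 * t := by
  induction t generalizing σ with
  | zero => simp
  | succ t ih =>
    rw [Function.iterate_succ_apply']
    refine (glauberOp_mono (g := fun η => 1 * (2 * plusCount η - n - m₀) ^ 2 + 168 * t)
      (fun η => by linarith [ih η]) σ).trans ?_
    have h1 := magOp_sq_le hn hwn hm hm3 hmn (plusCount_nonneg σ) (plusCount_le σ)
    rw [glauberOp_add_const hn,
      glauberOp_comp_plusCount hn fun j => (2 * (j : ℝ) - n - m₀) ^ 2]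
    push_cast
    linarith

lemma exists_initial_magnetization (hn : 0 < n) {w : ℝ} (hw : 1 ≤ w) (hwn : w ^ 4 = n ^ 3) :
    ∃ k : ℤ, 0 ≤ k ∧ k ≤ n ∧ w ≤ 2 * k - n ∧ 2 * k - n ≤ 3 * w ∧ (2 * k - n : ℝ) ≤ n := by
  have h1 : (1 : ℝ) ≤ n := by exact_mod_cast hn
  have hwn' : w ≤ n := by
    refine le_of_pow_le_pow_left₀ (n := 4) (by norm_num) (by linarith) ?_
    rw [hwn]
    exact pow_le_pow_right₀ h1 (by norm_num)
  have h2 := Int.le_ceil ((n + w) / 2)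
  have h3 := Int.ceil_lt_add_one ((n + w) / 2)
  have h4 : ⌈(n + w) / 2⌉ ≤ (n : ℤ) := Int.ceil_le.2 (by push_cast; linarith)
  have h5 : (⌈(n + w) / 2⌉ : ℝ) ≤ n := by exact_mod_cast h4
  exact ⟨⌈(n + w) / 2⌉, Int.ceil_nonneg (by linarith), h4, by linarith, by linarith, by linarith⟩

lemma le_of_glauberDist_le (hn : 0 < n) {w : ℝ} (hw : 1 ≤ w) (hwn : w ^ 4 = n ^ 3) {t : ℕ}
    (ht : glauberDist 1 n t ≤ 1 / 4) : w ^ 2 / 672 ≤ t := by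
  obtain ⟨k, hk, hkn, hkw, hkw3, hkn'⟩ := exists_initial_magnetization hn hw hwn
  obtain ⟨σ, hσ⟩ := exists_plusCount_eq hk hkn
  set m₀ : ℝ := 2 * k - n with hm₀
  have hm : 0 < m₀ := by linarith
  let f : Config n → ℝ := fun η => SignType.sign (2 * (plusCount η : ℝ) - n)
  have hf : ∀ η, |f η| ≤ 1 := fun η => by
    simp only [f]
    rcases SignType.sign (2 * (plusCount η : ℝ) - n) with _ | _ | _ <;> simp
  have hodd : ∀ η : Config n, f (fun i => !η i) = -f η := fun η => by
    simp only [f, plusCount_not]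
    push_cast
    rw [show 2 * ((n : ℝ) - plusCount η) - n = -(2 * plusCount η - n) by ring, Left.sign_neg]
    simp
  have htv : tvDist (glauberLaw 1 n t σ) (cwMeasure 1 n) ≤ 1 / 4 :=
    (le_ciSup (f := fun σ => tvDist (glauberLaw 1 n t σ) (cwMeasure 1 n))
      (Set.finite_range _).bddAbove σ).trans ht
  have h1 := sum_mul_sub_sum_mul_le (glauberLaw 1 n t σ) (cwMeasure 1 n) hf
  rw [sum_glauberLaw_mul, sum_cwMeasure_mul_eq_zero hodd] at h1
  have hle : ∀ η : Config n,
      -(2 / m₀ ^ 2) * (2 * (plusCount η : ℝ) - n - m₀) ^ 2 + 1 ≤ f η := fun η => by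
    simp only [f]
    set z : ℝ := 2 * (plusCount η : ℝ) - n
    have hq : 0 ≤ 2 / m₀ ^ 2 := by positivity
    rcases lt_or_ge 0 z with hz | hz
    · rw [sign_pos hz]
      simp only [SignType.coe_one]
      nlinarith [mul_nonneg hq (sq_nonneg (z - m₀))]
    · have h2 : m₀ ^ 2 ≤ (z - m₀) ^ 2 := by nlinarith
      have h3 : 2 / m₀ ^ 2 * m₀ ^ 2 = 2 := by field_simp
      have h4 : (-1 : ℝ) ≤ SignType.sign z := by
        rcases SignType.sign z with _ | _ | _ <;> simp
      nlinarith [mul_le_mul_of_nonneg_left h2 hq]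
  have h5 := glauberOp_iterate_mono hle t σ
  rw [glauberOp_iterate_add_const hn] at h5
  have h6 := glauberOp_iterate_sq_le hn hwn hm.le hkw3 hkn' t σ
  rw [hσ, ← hm₀, sub_self, zero_pow two_ne_zero, zero_add] at h6
  have h7 := mul_le_mul_of_nonneg_left h6 (show 0 ≤ 2 / m₀ ^ 2 by positivity)
  have h8 : 1 / 2 ≤ 2 / m₀ ^ 2 * (168 * t) := by linarith
  have h9 : m₀ ^ 2 ≤ 672 * t := by
    rw [div_mul_eq_mul_div, le_div_iff₀ (by positivity)] at h8
    linarith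
  have h10 : w ^ 2 ≤ m₀ ^ 2 := pow_le_pow_left₀ (by linarith) hkw 2
  linarith

end LowerBound

/-! ### The mixing time -/

lemma tMix_zero : tMix 1 0 = 0 := by
  refine Nat.sInf_eq_zero.2 (Or.inl ?_)
  change glauberDist 1 0 0 ≤ 1 / 4
  refine ciSup_le fun σ => ?_
  have hμ := sum_cwMeasure (n := 0)
  rw [Finset.sum_eq_single_of_mem σ (Finset.mem_univ σ)
    fun η _ h => absurd (Subsingleton.elim η σ) h] at hμ
  have h : tvDist (glauberLaw 1 0 0 σ) (cwMeasure 1 0) = 0 := by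
    rw [tvDist, Finset.sum_eq_single_of_mem σ (Finset.mem_univ σ)
      fun η _ h => absurd (Subsingleton.elim η σ) h, hμ]
    simp [glauberLaw]
  rw [h]
  norm_num

lemma tMix_bounds {n : ℕ} (hn : 0 < n) {w : ℝ} (hw : 1 ≤ w) (hwn : w ^ 4 = n ^ 3) :
    w ^ 2 / 672 ≤ tMix 1 n ∧ tMix 1 n ≤ 20738 * w ^ 2 := by
  set T := ⌈10368 * w ^ 2⌉₊ with hT
  have h := glauberDist_le hn hw hwn (Nat.le_ceil (10368 * w ^ 2))
  rw [← hT] at h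
  refine ⟨le_of_glauberDist_le hn hw hwn
    (Nat.sInf_mem (s := {t | glauberDist 1 n t ≤ 1 / 4}) ⟨T + T, h⟩), ?_⟩
  have h1 : tMix 1 n ≤ T + T := Nat.sInf_le h
  have h2 : (tMix 1 n : ℝ) ≤ T + T := by exact_mod_cast h1
  have h3 := Nat.ceil_lt_add_one (show 0 ≤ 10368 * w ^ 2 by positivity)
  have h4 : 1 ≤ w ^ 2 := one_le_pow₀ hw
  linarith

/-- At the critical temperature `β = 1`, the mixing time of the Glauber
dynamics for the Curie-Weiss model on `Kₙ` is of order `n^(3/2)`. -/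
theorem cw_critical_mixing :
    ∃ C₁ > (0 : ℝ), ∃ C₂ > (0 : ℝ), ∀ n : ℕ,
      C₁ * (n : ℝ) ^ (3 / 2 : ℝ) ≤ (tMix 1 n : ℝ) ∧
      (tMix 1 n : ℝ) ≤ C₂ * (n : ℝ) ^ (3 / 2 : ℝ) := by
  refine ⟨1 / 672, by norm_num, 20738, by norm_num, fun n => ?_⟩
  rcases n.eq_zero_or_pos with rfl | hn
  · rw [tMix_zero, Nat.cast_zero, Real.zero_rpow (by norm_num)]
    norm_num
  have hw : 1 ≤ (n : ℝ) ^ (3 / 4 : ℝ) :=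
    Real.one_le_rpow (by exact_mod_cast hn) (by norm_num)
  have hw4 : ((n : ℝ) ^ (3 / 4 : ℝ)) ^ 4 = (n : ℝ) ^ 3 := by
    rw [← Real.rpow_mul_natCast n.cast_nonneg, ← Real.rpow_natCast]
    norm_num
  have hw2 : ((n : ℝ) ^ (3 / 4 : ℝ)) ^ 2 = (n : ℝ) ^ (3 / 2 : ℝ) := by
    rw [← Real.rpow_mul_natCast n.cast_nonneg]
    norm_num
  obtain ⟨h1, h2⟩ := tMix_bounds hn hw hw4
  rw [hw2] at h1 h2
  exact ⟨by linarith, h2⟩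

end

end CW
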